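/- Any bounded viscosity subsolution u of the Hamilton–Jacobi equation is Lipschitz continuous in a neighborhood of the interface: there exist r > 0 and L > 0 such that |u(x) − u(y)| ≤ L·d(x,y) for all x, y ∈ B(Γ,r) ∩ S, where d denotes the geodesic distance on S. -/

import Mathlib

open scoped RealInnerProductSpace
open Set Metric MeasureTheory

noncomputable section

abbrev E3 : Type := EuclideanSpace ℝ (Fin 3)

/-- The closed half-plane `ℝ e0 × ℝ₊ ei`. -/
def halfPlane (e0 ei : E3) : Set E3 :=
  {x | ∃ x0 xi : ℝ, 0 ≤ xi ∧ x = x0 • e0 + xi • ei}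

/-- The interface `Γ = ℝ e0`. -/
def iface (e0 : E3) : Set E3 := {x | ∃ t : ℝ, x = t • e0}

/-- The junction `S = ⋃ i Pᵢ`. -/
def junction (N : ℕ) (e0 : E3) (e : Fin N → E3) : Set E3 :=
  ⋃ i, halfPlane e0 (e i)

/-- Admissible test functions on the junction: continuous on `S`, `C¹` on each
half-plane `Pᵢ`, with `Dφ i x ∈ ℝ e0 + ℝ eᵢ` the gradient of `φ|_{Pᵢ}`. -/
structure TestFun (N : ℕ) (e0 : E3) (e : Fin N → E3) where
  φ : E3 → ℝ
  Dφ : Fin N → E3 → E3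
  cont : ContinuousOn φ (junction N e0 e)
  dphi_plane : ∀ i, ∀ x ∈ halfPlane e0 (e i), ∃ c0 ci : ℝ, Dφ i x = c0 • e0 + ci • e i
  hasDeriv : ∀ i, ∀ x ∈ halfPlane e0 (e i),
    HasFDerivWithinAt φ (innerSL ℝ (Dφ i x)) (halfPlane e0 (e i)) x
  contDeriv : ∀ i, ContinuousOn (Dφ i) (halfPlane e0 (e i))

/-- Viscosity subsolution of `λ u(x) + sup_{(ζ,ξ) ∈ FL(x)} {-Du(x,ζ) - ξ} = 0` on `S`,
where `FL(x) = FLᵢ(x)` if `x ∈ Pᵢ \ Γ` and `FL(x) = ⋃ᵢ FLᵢ⁺(x)` if `x ∈ Γ`. -/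
def IsSubSol (N : ℕ) (e0 : E3) (e : Fin N → E3) {A : Type} [MetricSpace A]
    (Ai : Fin N → Set A) (f : Fin N → E3 → A → E3) (ℓ : Fin N → E3 → A → ℝ)
    (lam : ℝ) (u : E3 → ℝ) : Prop :=
  ∀ x ∈ junction N e0 e, ∀ ψ : TestFun N e0 e,
    IsLocalMaxOn (fun y => u y - ψ.φ y) (junction N e0 e) x →
    ∀ i, x ∈ halfPlane e0 (e i) → ∀ a ∈ Ai i,
      (x ∉ iface e0 ∨ 0 ≤ ⟪f i x a, e i⟫) →
      lam * u x - ⟪ψ.Dφ i x, f i x a⟫ - ℓ i x a ≤ 0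

/-- Viscosity supersolution of the same Hamilton-Jacobi equation on `S`. -/
def IsSuperSol (N : ℕ) (e0 : E3) (e : Fin N → E3) {A : Type} [MetricSpace A]
    (Ai : Fin N → Set A) (f : Fin N → E3 → A → E3) (ℓ : Fin N → E3 → A → ℝ)
    (lam : ℝ) (v : E3 → ℝ) : Prop :=
  ∀ x ∈ junction N e0 e, ∀ ψ : TestFun N e0 e,
    IsLocalMinOn (fun y => v y - ψ.φ y) (junction N e0 e) x →
    ∃ i, x ∈ halfPlane e0 (e i) ∧ ∃ a ∈ Ai i,
      (x ∉ iface e0 ∨ 0 ≤ ⟪f i x a, e i⟫) ∧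
      0 ≤ lam * v x - ⟪ψ.Dφ i x, f i x a⟫ - ℓ i x a

lemma norm_sq_smul_add_smul {e0 v : E3} (h0 : ‖e0‖ = 1) (hv : ‖v‖ = 1) (h : ⟪v, e0⟫ = 0)
    (a b : ℝ) : ‖a • e0 + b • v‖ ^ 2 = a ^ 2 + b ^ 2 := by
  rw [norm_add_sq_real, norm_smul, norm_smul, real_inner_smul_left, real_inner_smul_right,
    real_inner_comm, h, h0, hv]
  simp

lemma iface_subset_halfPlane (e0 v : E3) : iface e0 ⊆ halfPlane e0 v := by
  rintro x ⟨t, rfl⟩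
  exact ⟨t, 0, le_rfl, by simp⟩

lemma iface_nonempty (e0 : E3) : (iface e0).Nonempty := ⟨0, 0, by simp⟩

lemma halfPlane_subset_junction {N : ℕ} (e0 : E3) (e : Fin N → E3) (k : Fin N) :
    halfPlane e0 (e k) ⊆ junction N e0 e :=
  subset_iUnion (fun i => halfPlane e0 (e i)) k

lemma isClosed_halfPlane {e0 v : E3} (h0 : ‖e0‖ = 1) (hv : ‖v‖ = 1) (h : ⟪v, e0⟫ = 0) :
    IsClosed (halfPlane e0 v) := by
  have heq : halfPlane e0 v =
      {x | 0 ≤ ⟪v, x⟫} ∩ {x | x = ⟪e0, x⟫ • e0 + ⟪v, x⟫ • v} := by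
    ext x
    constructor
    · rintro ⟨a, b, hb, rfl⟩
      have h' : ⟪e0, v⟫ = 0 := by rw [real_inner_comm]; exact h
      have e1 : ⟪v, a • e0 + b • v⟫ = b := by
        simp [inner_add_right, real_inner_smul_right, h, hv]
      have e2 : ⟪e0, a • e0 + b • v⟫ = a := by
        simp [inner_add_right, real_inner_smul_right, h', h0]
      simp only [mem_inter_iff, mem_ofPred_eq, e1, e2]
      exact ⟨hb, trivial⟩
    · rintro ⟨h1, h2⟩
      exact ⟨_, _, h1, h2⟩
  rw [heq]
  exact (isClosed_le continuous_const (by fun_prop)).inter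
    (isClosed_eq continuous_id (by fun_prop))

lemma halfPlane_inter_subset_iface {e0 v w : E3} (h0 : ‖e0‖ = 1) (hv : ‖v‖ = 1) (hw : ‖w‖ = 1)
    (hv0 : ⟪v, e0⟫ = 0) (hw0 : ⟪w, e0⟫ = 0) (hvw : v ≠ w) :
    halfPlane e0 v ∩ halfPlane e0 w ⊆ iface e0 := by
  rintro x ⟨⟨a, b, hb, hx⟩, a', b', hb', hx'⟩
  have h1 : ⟪x, e0⟫ = a := by
    rw [hx]; simp [inner_add_left, real_inner_smul_left, hv0, h0]
  have h2 : ⟪x, e0⟫ = a' := by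
    rw [hx']; simp [inner_add_left, real_inner_smul_left, hw0, h0]
  obtain rfl : a = a' := h1.symm.trans h2
  have h3 : b • v = b' • w := add_left_cancel (hx.symm.trans hx')
  have h4 : b = b' := by
    have := congrArg norm h3
    simpa [norm_smul, hv, hw, abs_of_nonneg hb, abs_of_nonneg hb'] using this
  subst h4
  by_cases hb0 : b = 0
  · exact ⟨a, by simp [hx, hb0]⟩
  · exact absurd (smul_right_injective E3 hb0 h3) hvw

/-- Continuous functions on the half-planes that agree on the interface glue to a continuous
function on the junction. -/
lemma exists_glue {N : ℕ} {e0 : E3} {e : Fin N → E3} (he0 : ‖e0‖ = 1) (he : ∀ k, ‖e k‖ = 1)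
    (heinj : Function.Injective e) (horth : ∀ k, ⟪e k, e0⟫ = 0) (g : Fin N → E3 → ℝ)
    (hg : ∀ k, Continuous (g k)) (hag : ∀ j k, ∀ x ∈ iface e0, g j x = g k x) :
    ∃ D : E3 → ℝ, ContinuousOn D (junction N e0 e) ∧
      ∀ k, ∀ x ∈ halfPlane e0 (e k), D x = g k x := by
  classical
  let D : E3 → ℝ := fun x =>
    if h : ∃ k, x ∈ halfPlane e0 (e k) then g h.choose x else 0
  have hD : ∀ k, ∀ x ∈ halfPlane e0 (e k), D x = g k x := by
    intro k x hx
    have hex : ∃ k, x ∈ halfPlane e0 (e k) := ⟨k, hx⟩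
    simp only [D, dif_pos hex]
    by_cases hk : hex.choose = k
    · rw [hk]
    · exact hag _ _ x (halfPlane_inter_subset_iface he0 (he _) (he k) (horth _) (horth k)
        (heinj.ne hk) ⟨hex.choose_spec, hx⟩)
  refine ⟨D, ?_, hD⟩
  exact (locallyFinite_of_finite _).continuousOn_iUnion
    (fun k => isClosed_halfPlane he0 (he k) (horth k))
    (fun k => (hg k).continuousOn.congr (hD k))

/-- The geodesic distance to the point `b0 • e0 + b • e i`, given on the `k`-th half-plane as the
Euclidean distance to a reflected point `Y k`. -/
lemma exists_geodesic_dist {N : ℕ} {e0 : E3} {e : Fin N → E3} (he0 : ‖e0‖ = 1)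
    (he : ∀ k, ‖e k‖ = 1) (heinj : Function.Injective e) (horth : ∀ k, ⟪e k, e0⟫ = 0)
    (i : Fin N) (b0 b : ℝ) (hb : 0 ≤ b) :
    ∃ (D : E3 → ℝ) (Y : Fin N → E3), ContinuousOn D (junction N e0 e) ∧
      Y i = b0 • e0 + b • e i ∧ (∀ k, ∃ c : ℝ, Y k = b0 • e0 + c • e k) ∧
      (∀ k, ∀ x ∈ halfPlane e0 (e k), D x = ‖x - Y k‖) ∧
      (∀ x ∈ junction N e0 e, ‖x - Y i‖ ≤ D x) := by
  classical
  let Y : Fin N → E3 := fun k => b0 • e0 + (if k = i then b else -b) • e k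
  have hYi : Y i = b0 • e0 + b • e i := by simp [Y]
  have hYne : ∀ k, k ≠ i → Y k = b0 • e0 + (-b) • e k := fun k hk => by simp [Y, hk]
  have hiface : ∀ k (t : ℝ), ‖t • e0 - Y k‖ ^ 2 = (t - b0) ^ 2 + b ^ 2 := by
    intro k t
    have : t • e0 - Y k = (t - b0) • e0 + (-(if k = i then b else -b)) • e k := by
      simp only [Y]; module
    rw [this, norm_sq_smul_add_smul he0 (he k) (horth k)]
    split_ifs <;> ring
  obtain ⟨D, hDc, hD⟩ := exists_glue he0 he heinj horth (fun k x => ‖x - Y k‖)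
    (fun k => by fun_prop) (by
      rintro j k x ⟨t, rfl⟩
      refine (sq_eq_sq₀ (norm_nonneg _) (norm_nonneg _)).1 ?_
      rw [hiface, hiface])
  refine ⟨D, Y, hDc, hYi, fun k => ⟨_, rfl⟩, hD, ?_⟩
  intro x hx
  obtain ⟨k, hk⟩ := mem_iUnion.1 hx
  rw [hD k x hk]
  by_cases hki : k = i
  · rw [hki]
  obtain ⟨a, c, hc, rfl⟩ := hk
  refine (sq_le_sq₀ (norm_nonneg _) (norm_nonneg _)).1 ?_
  have h1 : a • e0 + c • e k - Y k = (a - b0) • e0 + (c + b) • e k := by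
    rw [hYne k hki]; module
  have h2 : a • e0 + c • e k - Y i = ((a - b0) • e0 + c • e k) - b • e i := by
    rw [hYi]; module
  have h3 : ⟪e0, e i⟫ = 0 := by rw [real_inner_comm]; exact horth i
  have h4 : -1 ≤ ⟪e k, e i⟫ := by
    have := abs_real_inner_le_norm (e k) (e i)
    rw [he, he, mul_one] at this
    exact (abs_le.1 this).1
  rw [h1, h2, norm_sq_smul_add_smul he0 (he k) (horth k), norm_sub_sq_real,
    norm_sq_smul_add_smul he0 (he k) (horth k), norm_smul, he, inner_add_left,
    real_inner_smul_left, real_inner_smul_left, real_inner_smul_right, real_inner_smul_right, h3,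
    Real.norm_eq_abs, abs_of_nonneg hb]
  nlinarith [mul_nonneg (mul_nonneg hb hc) (by linarith : 0 ≤ 1 + ⟪e k, e i⟫)]

/-- The test function `c * (D ^ 2 + s)`, where `D` is the distance to `Y k` on the `k`-th
half-plane. -/
def TestFun.ofDistSq {N : ℕ} {e0 : E3} {e : Fin N → E3} {D : E3 → ℝ} {Y : Fin N → E3} {b0 : ℝ}
    (hDc : ContinuousOn D (junction N e0 e)) (hY : ∀ k, ∃ c : ℝ, Y k = b0 • e0 + c • e k)
    (hD : ∀ k, ∀ x ∈ halfPlane e0 (e k), D x = ‖x - Y k‖) (c s : ℝ) : TestFun N e0 e where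
  φ x := c * (D x ^ 2 + s)
  Dφ k x := (2 * c) • (x - Y k)
  cont := continuousOn_const.mul ((hDc.pow 2).add continuousOn_const)
  dphi_plane := by
    rintro k x ⟨a, b, -, rfl⟩
    obtain ⟨d, hd⟩ := hY k
    exact ⟨2 * c * (a - b0), 2 * c * (b - d), by rw [hd]; module⟩
  hasDeriv := by
    intro k x hx
    have h1 : HasFDerivWithinAt (fun y => c * (‖y - Y k‖ ^ 2 + s))
        (innerSL ℝ ((2 * c) • (x - Y k))) (halfPlane e0 (e k)) x := by
      have := ((((hasFDerivAt_id x).sub_const (Y k)).norm_sq).add_const s).const_mul c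
      refine (this.congr_fderiv ?_).hasFDerivWithinAt
      ext v
      simp
      ring
    exact h1.congr (fun y hy => by rw [hD k y hy]) (by rw [hD k x hx])
  contDeriv k := by fun_prop

/-- Near the interface, controllability provides a dynamics opposing a given unit direction. -/
lemma exists_control {e0 v : E3} {A : Type} {B : Set A} {F : E3 → A → E3} {Lf δ : ℝ} (hδ : 0 < δ)
    (hflip : ∀ x ∈ halfPlane e0 v, ∀ y ∈ halfPlane e0 v, ∀ a ∈ B,
      ‖F x a - F y a‖ ≤ Lf * ‖x - y‖)
    (hctr : ∀ x ∈ iface e0, ∀ w : E3, ‖w‖ < δ →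
      (∃ c0 ci : ℝ, w = c0 • e0 + ci • v) → ∃ a ∈ B, F x a = w)
    {x z p : E3} (hx : x ∈ halfPlane e0 v) (hz : z ∈ iface e0)
    (hxz : Lf * ‖x - z‖ ≤ δ / 4) (hp : ‖p‖ = 1) (hpv : ∃ c0 c : ℝ, p = c0 • e0 + c • v) :
    ∃ a ∈ B, F z a = -(δ / 2) • p ∧ ⟪p, F x a⟫ ≤ -(δ / 4) := by
  obtain ⟨c0, c, hc⟩ := hpv
  obtain ⟨a, ha, hFa⟩ := hctr z hz (-(δ / 2) • p)
    (by rw [norm_smul, hp, Real.norm_eq_abs, abs_neg, abs_of_pos (by positivity)]; linarith)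
    ⟨-(δ / 2) * c0, -(δ / 2) * c, by rw [hc]; module⟩
  refine ⟨a, ha, hFa, ?_⟩
  have h1 := (hflip x hx z (iface_subset_halfPlane _ _ hz) a ha).trans hxz
  have h2 : ⟪p, F x a⟫ = ⟪p, F x a - F z a⟫ + ⟪p, F z a⟫ := by
    rw [← inner_add_right, sub_add_cancel]
  have h3 : ⟪p, F z a⟫ = -(δ / 2) := by
    rw [hFa, real_inner_smul_right, real_inner_self_eq_norm_sq, hp]; ring
  have h4 := real_inner_le_norm p (F x a - F z a)
  rw [hp, one_mul] at h4
  linarith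

/-- Any bounded viscosity subsolution is Lipschitz continuous, for the geodesic
distance, in a neighborhood of the interface. -/
theorem stmt_17
    (N : ℕ) (hN : 2 ≤ N) (e0 : E3) (e : Fin N → E3)
    (he0 : ‖e0‖ = 1) (he : ∀ k, ‖e k‖ = 1)
    (heinj : Function.Injective e) (hee0 : ∀ k, e k ≠ e0)
    (horth : ∀ k, ⟪e k, e0⟫ = 0)
    {A : Type} [MetricSpace A] (Ai : Fin N → Set A)
    (hAne : ∀ k, (Ai k).Nonempty) (hAcp : ∀ k, IsCompact (Ai k))
    (hAdisj : ∀ k l, k ≠ l → Disjoint (Ai k) (Ai l))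
    (f : Fin N → E3 → A → E3) (Mf Lf : ℝ)
    (hfcont : ∀ k, ContinuousOn (fun q : E3 × A => f k q.1 q.2)
      ((halfPlane e0 (e k)) ×ˢ (Ai k)))
    (hfplane : ∀ k, ∀ x ∈ halfPlane e0 (e k), ∀ a ∈ Ai k,
      ∃ c0 ci : ℝ, f k x a = c0 • e0 + ci • e k)
    (hfbdd : ∀ k, ∀ x ∈ halfPlane e0 (e k), ∀ a ∈ Ai k, ‖f k x a‖ ≤ Mf)
    (hflip : ∀ k, ∀ x ∈ halfPlane e0 (e k), ∀ y ∈ halfPlane e0 (e k), ∀ a ∈ Ai k,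
      ‖f k x a - f k y a‖ ≤ Lf * ‖x - y‖)
    (ℓ : Fin N → E3 → A → ℝ) (Mℓ : ℝ) (ω : ℝ → ℝ)
    (hωmono : Monotone ω) (hω0 : ω 0 = 0)
    (hlcont : ∀ k, ContinuousOn (fun q : E3 × A => ℓ k q.1 q.2)
      ((halfPlane e0 (e k)) ×ˢ (Ai k)))
    (hlbdd : ∀ k, ∀ x ∈ halfPlane e0 (e k), ∀ a ∈ Ai k, |ℓ k x a| ≤ Mℓ)
    (hlmod : ∀ k, ∀ x ∈ halfPlane e0 (e k), ∀ y ∈ halfPlane e0 (e k), ∀ a ∈ Ai k,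
      |ℓ k x a - ℓ k y a| ≤ ω ‖x - y‖)
    (hH2 : ∀ k, ∀ x ∈ halfPlane e0 (e k),
      Convex ℝ {q : E3 × ℝ | ∃ a ∈ Ai k, q = (f k x a, ℓ k x a)})
    (δ : ℝ) (hδ : 0 < δ)
    (hH3 : ∀ k, ∀ x ∈ iface e0, ∀ w : E3, ‖w‖ < δ →
      (∃ c0 ci : ℝ, w = c0 • e0 + ci • e k) → ∃ a ∈ Ai k, f k x a = w)
    (lam : ℝ) (hlam : 0 < lam)
    (u : E3 → ℝ) (husc : UpperSemicontinuousOn u (junction N e0 e))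
    (Mu : ℝ) (hMu : ∀ x ∈ junction N e0 e, |u x| ≤ Mu)
    (hu : IsSubSol N e0 e Ai f ℓ lam u) :
    ∃ r L : ℝ, 0 < r ∧ 0 < L ∧
      (∀ i : Fin N, ∀ x ∈ halfPlane e0 (e i), ∀ y ∈ halfPlane e0 (e i),
        Metric.infDist x (iface e0) < r → Metric.infDist y (iface e0) < r →
        |u x - u y| ≤ L * ‖x - y‖) ∧
      (∀ i j : Fin N, i ≠ j → ∀ x ∈ halfPlane e0 (e i), ∀ y ∈ halfPlane e0 (e j),
        Metric.infDist x (iface e0) < r → Metric.infDist y (iface e0) < r →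
        ∀ z ∈ iface e0, |u x - u y| ≤ L * (‖x - z‖ + ‖z - y‖)) := by
  have hMu0 : 0 ≤ Mu := (abs_nonneg (u 0)).trans
    (hMu 0 (halfPlane_subset_junction e0 e ⟨0, by omega⟩ ⟨0, 0, le_rfl, by simp⟩))
  set r : ℝ := δ / (8 * (|Lf| + 1)) with hr
  have hr0 : 0 < r := by positivity
  have hLr : |Lf| * (r + r) ≤ δ / 4 := by
    have : (|Lf| + 1) * (r + r) = δ / 4 := by rw [hr]; field_simp; norm_num
    nlinarith
  set L : ℝ := (2 * Mu + 1) / r + 4 * (lam * Mu + |Mℓ| + 1) / δ with hL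
  have hL1 : 2 * Mu < L * r := by
    have h1 : (2 * Mu + 1) / r * r = 2 * Mu + 1 := by field_simp
    have h2 : 0 ≤ 4 * (lam * Mu + |Mℓ| + 1) / δ * r := by positivity
    rw [hL, add_mul]; linarith
  have hL2 : lam * Mu + |Mℓ| < L * (δ / 4) := by
    have h1 : 4 * (lam * Mu + |Mℓ| + 1) / δ * (δ / 4) = lam * Mu + |Mℓ| + 1 := by field_simp
    have h2 : 0 ≤ (2 * Mu + 1) / r * (δ / 4) := by positivity
    rw [hL, add_mul]; linarith
  have hL0 : 0 < L := by positivity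
  have hclosed : IsClosed (junction N e0 e) :=
    isClosed_iUnion_of_finite fun k => isClosed_halfPlane he0 (he k) (horth k)
  have key : ∀ i, ∀ x ∈ halfPlane e0 (e i), ∀ y ∈ halfPlane e0 (e i),
      infDist y (iface e0) < r → u x - u y ≤ L * ‖x - y‖ := by
    intro i x hx y hy hyr
    obtain ⟨b0, b, hb, hyb⟩ := id hy
    obtain ⟨D, Y, hDc, hYi, hY, hD, hDY⟩ := exists_geodesic_dist he0 he heinj horth i b0 b hb
    rw [← hyb] at hYi
    have hxS := halfPlane_subset_junction e0 e i hx
    have hyS := halfPlane_subset_junction e0 e i hy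
    by_contra! hcon
    have hDx : D x = ‖x - y‖ := by rw [hD i x hx, hYi]
    rw [← hDx] at hcon
    -- where `u - L * D` exceeds `u y`, the point is close to `y`
    have hnear : ∀ w ∈ junction N e0 e, L * D w < u w - u y → dist w y < r := by
      intro w hw hlt
      have h1 := abs_le.1 (hMu w hw)
      have h2 := abs_le.1 (hMu y hyS)
      have h3 := hDY w hw
      rw [hYi] at h3
      rw [dist_eq_norm]
      exact lt_of_mul_lt_mul_left (by nlinarith) hL0.le
    have hcpt : IsCompact (junction N e0 e ∩ closedBall y r) :=
      (isCompact_closedBall y r).inter_left hclosed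
    have hneg : ContinuousOn (fun v => -L * D v) (junction N e0 e ∩ closedBall y r) :=
      continuousOn_const.mul (hDc.mono inter_subset_left)
    obtain ⟨w, ⟨hwS, hwB⟩, hwmax⟩ := UpperSemicontinuousOn.exists_isMaxOn
      (s := junction N e0 e ∩ closedBall y r) ⟨y, hyS, mem_closedBall_self hr0.le⟩ hcpt
      ((husc.mono inter_subset_left).add hneg.upperSemicontinuousOn)
    have hwx := hwmax ⟨hxS, (hnear x hxS hcon).le⟩
    simp only [mem_ofPred_eq] at hwx
    have hwcon : L * D w < u w - u y := by linarith
    have hwy := hnear w hwS hwcon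
    have hDw := hDY w hwS
    rw [hYi] at hDw
    have hη : 0 < D w := by
      refine lt_of_le_of_ne ((norm_nonneg _).trans hDw) fun h0 => ?_
      rw [← h0] at hDw hwcon
      have : w = y := sub_eq_zero.1 (norm_le_zero_iff.1 hDw)
      rw [this] at hwcon
      simp at hwcon
    set η := D w with hηdef
    -- a smooth function touching `L * D` from above at `w`
    have hmax : IsLocalMaxOn
        (fun v => u v - (TestFun.ofDistSq hDc hY hD (L / (2 * η)) (η ^ 2)).φ v)
        (junction N e0 e) w := by
      filter_upwards [self_mem_nhdsWithin,
        mem_nhdsWithin_of_mem_nhds (isOpen_ball.mem_nhds hwy)] with v hv hvB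
      have h1 := hwmax ⟨hv, ball_subset_closedBall hvB⟩
      simp only [mem_ofPred_eq] at h1
      have h2 : L / (2 * η) * (D v ^ 2 + η ^ 2) = L * D v + L / (2 * η) * (D v - η) ^ 2 := by
        field_simp; ring
      have h3 : L / (2 * η) * (D w ^ 2 + η ^ 2) = L * η := by
        rw [← hηdef]; field_simp; ring
      have h4 : 0 ≤ L / (2 * η) * (D v - η) ^ 2 := by positivity
      simp only [TestFun.ofDistSq]
      rw [h2, h3]
      linarith
    obtain ⟨k, z, hwk, hz, hwz, hin⟩ : ∃ k z, w ∈ halfPlane e0 (e k) ∧ z ∈ iface e0 ∧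
        Lf * ‖w - z‖ ≤ δ / 4 ∧ (w ∉ iface e0 ∨ z = w ∧ k = i) := by
      by_cases hw : w ∈ iface e0
      · exact ⟨i, w, iface_subset_halfPlane _ _ hw, hw, by simp; positivity, Or.inr ⟨rfl, rfl⟩⟩
      obtain ⟨k, hk⟩ := mem_iUnion.1 hwS
      obtain ⟨z, hz, hyz⟩ := (infDist_lt_iff (iface_nonempty e0)).1 hyr
      refine ⟨k, z, hk, hz, ?_, Or.inl hw⟩
      have h1 := dist_triangle w y z
      rw [← dist_eq_norm]
      calc Lf * dist w z ≤ |Lf| * (r + r) :=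
            mul_le_mul (le_abs_self _) (by linarith) dist_nonneg (abs_nonneg _)
        _ ≤ δ / 4 := hLr
    have hηk : ‖w - Y k‖ = η := (hD k w hwk).symm
    obtain ⟨a, ha, hfz, hpf⟩ := exists_control hδ (hflip k) (hH3 k) hwk hz hwz
      (p := η⁻¹ • (w - Y k))
      (by rw [norm_smul, hηk, Real.norm_eq_abs, abs_of_pos (inv_pos.2 hη),
        inv_mul_cancel₀ hη.ne'])
      (by
        obtain ⟨s, t, -, hst⟩ := hwk
        obtain ⟨d, hd⟩ := hY k
        exact ⟨η⁻¹ * (s - b0), η⁻¹ * (t - d), by rw [hd, hst]; module⟩)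
    have hinward : w ∉ iface e0 ∨ 0 ≤ ⟪f k w a, e k⟫ := by
      refine hin.imp_right ?_
      rintro ⟨rfl, rfl⟩
      obtain ⟨t, ht⟩ := hz
      have h0 : ⟪e0, e k⟫ = 0 := by rw [real_inner_comm]; exact horth k
      have : ⟪z - Y k, e k⟫ = -b := by
        rw [hYi, hyb, ht]
        simp [inner_sub_left, inner_add_left, real_inner_smul_left, h0, he]
      rw [hfz, real_inner_smul_left, real_inner_smul_left, this]
      have : 0 ≤ δ / 2 * (η⁻¹ * b) := by positivity
      linarith
    have hsub := hu w hwS _ hmax k hwk a ha hinward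
    have hgrad : ⟪(TestFun.ofDistSq hDc hY hD (L / (2 * η)) (η ^ 2)).Dφ k w, f k w a⟫ =
        L * ⟪η⁻¹ • (w - Y k), f k w a⟫ := by
      simp only [TestFun.ofDistSq, real_inner_smul_left]
      field_simp
    rw [hgrad] at hsub
    have h1 := (abs_le.1 (hMu w hwS)).1
    have h2 := (abs_le.1 ((hlbdd k w hwk a ha).trans (le_abs_self _))).2
    nlinarith [mul_le_mul_of_nonneg_left hpf hL0.le, mul_le_mul_of_nonneg_left h1 hlam.le]
  have same : ∀ i : Fin N, ∀ x ∈ halfPlane e0 (e i), ∀ y ∈ halfPlane e0 (e i),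
      infDist x (iface e0) < r → infDist y (iface e0) < r → |u x - u y| ≤ L * ‖x - y‖ := by
    intro i x hx y hy hxr hyr
    refine abs_le.2 ⟨?_, key i x hx y hy hyr⟩
    have := key i y hy x hx hxr
    rw [norm_sub_rev] at this
    linarith
  refine ⟨r, L, hr0, hL0, same, ?_⟩
  intro i j _ x hx y hy hxr hyr z hz
  have hzr : infDist z (iface e0) < r := by rwa [infDist_zero_of_mem hz]
  have h1 := same i x hx z (iface_subset_halfPlane _ _ hz) hxr hzr
  have h2 := same j z (iface_subset_halfPlane _ _ hz) y hy hzr hyr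
  have h3 := abs_sub_le (u x) (u z) (u y)
  linarith
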